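/- Let 0 < c < τ, let B : ℝ² → ℝ be continuous with support contained in the disk B(0,c), and define the Landau-gauge potential A₁(x,y) = −∫_0^y B(x,t) dt. Let Ṽ : ℝ → ℝ be continuous and bounded, e ∈ ℝ, and let g : ℝ → ℝ be twice continuously differentiable with g(t) > 0 for all t and −g''(y) − Ṽ(y) g(y) = e g(y) for all y ∈ ℝ. Let γ₁, γ₂ : [−c,c] → ℝ be continuous with −√(τ²−x²) ≤ γ₁(x) ≤ γ₂(x) ≤ √(τ²−x²) for all x, set Ω = {(x,y) : x ∈ (−c,c), γ₁(x) < y < γ₂(x)} and δ = sup_{x∈[−c,c]}(γ₂(x) − γ₁(x)) > 0. Let V : ℝ² → ℝ be measurable and locally bounded with V(x,y) = Ṽ(y) for all (x,y) ∉ Ω. Assume the magnetic Hardy inequality: there is 𝓜 > 0 such that ∫_{B(0,τ)} ( |i ∂_x φ + A₁ φ|² + |∂_y φ|² ) dx dy ≥ 𝓜 ∫_{B(0,τ)} |φ|² dx dy for every smooth compactly supported φ : ℝ² → ℂ. Set β = min_{t∈[−τ,τ]} g(t)² and Γ = max_{t∈[−τ,τ]} g(t)². If sup_{(x,y)∈Ω}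 |Ṽ(y) − V(x,y)| ≤ (β/Γ) · min( 𝓜 √(τ²−c²)/2, 1/(8τ) ) · δ^{−1}, then for every smooth compactly supported φ : ℝ² → ℂ, setting ψ(x,y) = φ(x,y) g(y), one has ∫_{ℝ²} ( |i ∂_x ψ + A₁ ψ|² + |∂_y ψ|² − V |ψ|² ) dx dy ≥ e ∫_{ℝ²} |ψ|² dx dy. -/

import Mathlib

open MeasureTheory

/-- First classical partial derivative of a function on `ℝ²`. -/
noncomputable def pd1 (f : ℝ × ℝ → ℂ) (z : ℝ × ℝ) : ℂ :=
  deriv (fun s => f (s, z.2)) z.1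

/-- Second classical partial derivative of a function on `ℝ²`. -/
noncomputable def pd2 (f : ℝ × ℝ → ℂ) (z : ℝ × ℝ) : ℂ :=
  deriv (fun t => f (z.1, t)) z.2

theorem sq_integral_norm_le {f : ℝ → ℂ} (hf : Continuous f) {a b : ℝ} (hab : a < b) :
    (∫ t in a..b, ‖f t‖) ^ 2 ≤ (b - a) * ∫ t in a..b, ‖f t‖ ^ 2 := by
  set I := ∫ t in a..b, ‖f t‖ with hI
  have hba : 0 < b - a := sub_pos.2 hab
  have h0 : 0 ≤ ∫ t in a..b, (‖f t‖ - I / (b - a)) ^ 2 :=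
    intervalIntegral.integral_nonneg hab.le fun t _ => sq_nonneg _
  have h1 : ∫ t in a..b, (‖f t‖ - I / (b - a)) ^ 2
      = (∫ t in a..b, ‖f t‖ ^ 2) - 2 * (I / (b - a)) * I + (I / (b - a)) ^ 2 * (b - a) := by
    have : ∀ t, (‖f t‖ - I / (b - a)) ^ 2
        = ‖f t‖ ^ 2 - 2 * (I / (b - a)) * ‖f t‖ + (I / (b - a)) ^ 2 := fun t => by ring
    simp_rw [this]
    rw [intervalIntegral.integral_add, intervalIntegral.integral_sub,
      intervalIntegral.integral_const_mul, intervalIntegral.integral_const, smul_eq_mul, ← hI]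
    · ring
    all_goals exact Continuous.intervalIntegrable (by fun_prop) _ _
  have h2 : (∫ t in a..b, ‖f t‖ ^ 2) - 2 * (I / (b - a)) * I + (I / (b - a)) ^ 2 * (b - a)
      = (∫ t in a..b, ‖f t‖ ^ 2) - I ^ 2 / (b - a) := by
    field_simp; ring
  rw [h1, h2, sub_nonneg, div_le_iff₀ hba] at h0
  linarith

theorem norm_sq_le_integral_norm_sq_add {f f' : ℝ → ℂ} (hf : ∀ t, HasDerivAt f (f' t) t)
    (hf' : Continuous f') {l y : ℝ} (hl : 0 < l) (hy : y ∈ Set.Icc (-l) l) :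
    ‖f y‖ ^ 2 ≤ 1 / l * (∫ t in -l..l, ‖f t‖ ^ 2) + 4 * l * ∫ t in -l..l, ‖f' t‖ ^ 2 := by
  have hfc : Continuous f := continuous_iff_continuousAt.2 fun t => (hf t).continuousAt
  have hll : -l < l := by linarith
  have hJ := sq_integral_norm_le hf' hll
  set J := ∫ t in -l..l, ‖f' t‖ ^ 2
  have hpt : ∀ t ∈ Set.Icc (-l) l, ‖f y‖ ^ 2 ≤ 2 * ‖f t‖ ^ 2 + 4 * l * J := by
    intro t ht
    have h1 : ∫ s in t..y, f' s = f y - f t :=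
      intervalIntegral.integral_eq_sub_of_hasDerivAt (fun s _ => hf s)
        (hf'.intervalIntegrable _ _)
    have h2 : ‖f y - f t‖ ≤ ∫ s in -l..l, ‖f' s‖ := by
      rw [← h1]
      refine intervalIntegral.norm_integral_le_integral_norm_uIoc.trans ?_
      rw [intervalIntegral.integral_of_le hll.le]
      refine setIntegral_mono_set ((hf'.norm.intervalIntegrable (-l) l).1)
        (Filter.Eventually.of_forall fun s => norm_nonneg _) (LE.le.eventuallyLE ?_)
      exact Set.Ioc_subset_Ioc (le_min ht.1 hy.1) (max_le ht.2 hy.2)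
    have h3 : ‖f y‖ ≤ ‖f t‖ + ‖f y - f t‖ := norm_le_norm_add_norm_sub' _ _
    have h4 : ‖f y - f t‖ ^ 2 ≤ (l - -l) * J := (pow_le_pow_left₀ (norm_nonneg _) h2 2).trans hJ
    nlinarith [norm_nonneg (f y), sq_nonneg (‖f t‖ - ‖f y - f t‖)]
  have hint : ∫ _ in -l..l, ‖f y‖ ^ 2 ≤ ∫ t in -l..l, (2 * ‖f t‖ ^ 2 + 4 * l * J) :=
    intervalIntegral.integral_mono_on hll.le (by simp)
      (Continuous.intervalIntegrable (by fun_prop) _ _) hpt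
  rw [intervalIntegral.integral_add (Continuous.intervalIntegrable (by fun_prop) _ _) (by simp),
    intervalIntegral.integral_const_mul, intervalIntegral.integral_const,
    intervalIntegral.integral_const, smul_eq_mul, smul_eq_mul] at hint
  rw [one_div_mul_eq_div, ← sub_le_iff_le_add, le_div_iff₀ hl]
  linarith

theorem HasCompactSupport.comp_prodMk_left {E : Type*} [Zero E] {f : ℝ × ℝ → E}
    (hf : HasCompactSupport f) (x : ℝ) : HasCompactSupport fun y => f (x, y) :=
  hf.comp_isClosedEmbedding (Topology.IsClosedEmbedding.of_continuous_injective_isClosedMap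
    (by fun_prop) (Prod.mk_right_injective x) (by
      intro s hs
      rw [← Set.singleton_prod]
      exact isClosed_singleton.prod hs))

theorem integral_eq_zero_of_hasDerivAt_snd {F F' : ℝ × ℝ → ℝ} (hF : Continuous F)
    (hF' : Continuous F') (hFs : HasCompactSupport F) (hFs' : HasCompactSupport F')
    (hd : ∀ x y, HasDerivAt (fun t => F (x, t)) (F' (x, y)) y) : ∫ z, F' z = 0 := by
  have hint : Integrable F' := hF'.integrable_of_hasCompactSupport hFs'
  rw [Measure.volume_eq_prod] at hint ⊢
  rw [integral_prod _ hint]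
  refine integral_eq_zero_of_ae (Filter.Eventually.of_forall fun x => ?_)
  exact integral_eq_zero_of_hasDerivAt_of_integrable (hd x)
    (Continuous.integrable_of_hasCompactSupport (by fun_prop) (hFs'.comp_prodMk_left x))
    (Continuous.integrable_of_hasCompactSupport (by fun_prop) (hFs.comp_prodMk_left x))

theorem pd1_eq_fderiv {φ : ℝ × ℝ → ℂ} (hφ : ContDiff ℝ (⊤ : ℕ∞) φ) :
    pd1 φ = fun z => fderiv ℝ φ z (1, 0) := by
  funext z
  have hl : HasDerivAt (fun s : ℝ => (s, z.2)) ((1 : ℝ), (0 : ℝ)) z.1 :=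
    (hasDerivAt_id _).prodMk (hasDerivAt_const _ _)
  exact (HasFDerivAt.comp_hasDerivAt z.1
    (hφ.differentiable (by simp) z).hasFDerivAt hl).deriv

theorem continuous_pd1 {φ : ℝ × ℝ → ℂ} (hφ : ContDiff ℝ (⊤ : ℕ∞) φ) : Continuous (pd1 φ) := by
  rw [pd1_eq_fderiv hφ]
  exact (hφ.continuous_fderiv (by simp)).clm_apply continuous_const

theorem pd2_eq_fderiv {φ : ℝ × ℝ → ℂ} (hφ : ContDiff ℝ (⊤ : ℕ∞) φ) :
    pd2 φ = fun z => fderiv ℝ φ z (0, 1) := by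
  funext z
  have hl : HasDerivAt (fun s : ℝ => (z.1, s)) ((0 : ℝ), (1 : ℝ)) z.2 :=
    (hasDerivAt_const _ _).prodMk (hasDerivAt_id _)
  exact (HasFDerivAt.comp_hasDerivAt z.2
    (hφ.differentiable (by simp) z).hasFDerivAt hl).deriv

theorem hasDerivAt_pd2 {φ : ℝ × ℝ → ℂ} (hφ : ContDiff ℝ (⊤ : ℕ∞) φ) (x y : ℝ) :
    HasDerivAt (fun t => φ (x, t)) (pd2 φ (x, y)) y := by
  have : DifferentiableAt ℝ (fun t => φ (x, t)) y :=
    (hφ.differentiable (by simp) (x, y)).comp y (by fun_prop)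
  exact this.hasDerivAt

theorem continuous_pd2 {φ : ℝ × ℝ → ℂ} (hφ : ContDiff ℝ (⊤ : ℕ∞) φ) : Continuous (pd2 φ) := by
  rw [pd2_eq_fderiv hφ]
  exact (hφ.continuous_fderiv (by simp)).clm_apply continuous_const

theorem hasCompactSupport_pd2 {φ : ℝ × ℝ → ℂ} (hφ : ContDiff ℝ (⊤ : ℕ∞) φ)
    (hs : HasCompactSupport φ) : HasCompactSupport (pd2 φ) := by
  rw [pd2_eq_fderiv hφ]
  exact hs.fderiv_apply (𝕜 := ℝ) (0, 1)

theorem hasCompactSupport_pd1 {φ : ℝ × ℝ → ℂ} (hφ : ContDiff ℝ (⊤ : ℕ∞) φ)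
    (hs : HasCompactSupport φ) : HasCompactSupport (pd1 φ) := by
  rw [pd1_eq_fderiv hφ]
  exact hs.fderiv_apply (𝕜 := ℝ) (1, 0)

theorem isOpen_disk (τ : ℝ) : IsOpen {z : ℝ × ℝ | z.1 ^ 2 + z.2 ^ 2 < τ ^ 2} :=
  isOpen_lt (by fun_prop) (by fun_prop)

theorem isOpen_region_between {c : ℝ} (hc : 0 < c) {γ₁ γ₂ : ℝ → ℝ}
    (hγ₁ : ContinuousOn γ₁ (Set.Icc (-c) c)) (hγ₂ : ContinuousOn γ₂ (Set.Icc (-c) c)) :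
    IsOpen {z : ℝ × ℝ | z.1 ∈ Set.Ioo (-c) c ∧ γ₁ z.1 < z.2 ∧ z.2 < γ₂ z.1} := by
  have hcc : -c ≤ c := by linarith
  have h₁ : Continuous (Set.IccExtend hcc ((Set.Icc (-c) c).domRestrict γ₁)) :=
    hγ₁.domRestrict.Icc_extend'
  have h₂ : Continuous (Set.IccExtend hcc ((Set.Icc (-c) c).domRestrict γ₂)) :=
    hγ₂.domRestrict.Icc_extend'
  have : {z : ℝ × ℝ | z.1 ∈ Set.Ioo (-c) c ∧ γ₁ z.1 < z.2 ∧ z.2 < γ₂ z.1}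
      = {z : ℝ × ℝ | z.1 ∈ Set.Ioo (-c) c} ∩
        ({z | Set.IccExtend hcc ((Set.Icc (-c) c).domRestrict γ₁) z.1 < z.2} ∩
         {z | z.2 < Set.IccExtend hcc ((Set.Icc (-c) c).domRestrict γ₂) z.1}) := by
    ext z
    refine and_congr_right fun hz => ?_
    simp only [Set.mem_inter_iff, Set.mem_ofPred_eq,
      Set.IccExtend_of_mem hcc _ (Set.Ioo_subset_Icc_self hz)]
    rfl
  rw [this]
  exact (isOpen_Ioo.preimage continuous_fst).inter
    ((isOpen_lt (h₁.comp continuous_fst) continuous_snd).inter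
      (isOpen_lt continuous_snd (h₂.comp continuous_fst)))

theorem setIntegral_region_norm_sq_le {c τ : ℝ} (hc : 0 < c) (hcτ : c < τ) {γ₁ γ₂ : ℝ → ℝ}
    (hγ₁ : ContinuousOn γ₁ (Set.Icc (-c) c)) (hγ₂ : ContinuousOn γ₂ (Set.Icc (-c) c))
    (hbound : ∀ x ∈ Set.Icc (-c) c,
      -Real.sqrt (τ ^ 2 - x ^ 2) ≤ γ₁ x ∧ γ₁ x ≤ γ₂ x ∧ γ₂ x ≤ Real.sqrt (τ ^ 2 - x ^ 2))
    {δ : ℝ} (hδ : ∀ x ∈ Set.Icc (-c) c, γ₂ x - γ₁ x ≤ δ) (hδ0 : 0 ≤ δ) {φ φ' : ℝ × ℝ → ℂ}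
    (hφ : Continuous φ) (hφ' : Continuous φ') (hs : HasCompactSupport φ)
    (hs' : HasCompactSupport φ')
    (hd : ∀ x y, HasDerivAt (fun t => φ (x, t)) (φ' (x, y)) y) :
    ∫ z in {z : ℝ × ℝ | z.1 ∈ Set.Ioo (-c) c ∧ γ₁ z.1 < z.2 ∧ z.2 < γ₂ z.1}, ‖φ z‖ ^ 2
      ≤ δ * ∫ z in {z : ℝ × ℝ | z.1 ^ 2 + z.2 ^ 2 < τ ^ 2},
        (1 / Real.sqrt (τ ^ 2 - c ^ 2) * ‖φ z‖ ^ 2 + 4 * τ * ‖φ' z‖ ^ 2) := by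
  have hΩ := (isOpen_region_between hc hγ₁ hγ₂).measurableSet
  have hD := (isOpen_disk τ).measurableSet
  have hφi : Integrable fun z => ‖φ z‖ ^ 2 :=
    Continuous.integrable_of_hasCompactSupport (by fun_prop)
      (hs.mono fun z hz => by simpa using hz)
  have hφi' : Integrable fun z => ‖φ' z‖ ^ 2 :=
    Continuous.integrable_of_hasCompactSupport (by fun_prop)
      (hs'.mono fun z hz => by simpa using hz)
  have hsum : Integrable fun z =>
      1 / Real.sqrt (τ ^ 2 - c ^ 2) * ‖φ z‖ ^ 2 + 4 * τ * ‖φ' z‖ ^ 2 :=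
    (hφi.const_mul _).add (hφi'.const_mul _)
  have hL := hφi.indicator hΩ
  have hR := hsum.indicator hD
  rw [← integral_indicator hΩ, ← integral_indicator hD]
  rw [Measure.volume_eq_prod] at hL hR ⊢
  rw [integral_prod _ hL, integral_prod _ hR, ← integral_const_mul]
  refine integral_mono hL.integral_prod_left (hR.integral_prod_left.const_mul _) fun x => ?_
  have hτ : 0 < τ := hc.trans hcτ
  by_cases hx : x ∈ Set.Ioo (-c) c
  · have hxI := Set.Ioo_subset_Icc_self hx
    obtain ⟨hb1, hb2, hb3⟩ := hbound x hxI
    have hxc : x ^ 2 < c ^ 2 := sq_lt_sq' hx.1 hx.2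
    have hcτ2 : c ^ 2 < τ ^ 2 := pow_lt_pow_left₀ hcτ hc.le two_ne_zero
    set l := Real.sqrt (τ ^ 2 - x ^ 2) with hl
    have hs0 : 0 < Real.sqrt (τ ^ 2 - c ^ 2) := Real.sqrt_pos.2 (by linarith)
    have hsl : Real.sqrt (τ ^ 2 - c ^ 2) ≤ l := Real.sqrt_le_sqrt (by linarith)
    have hlτ : l ≤ τ := Real.sqrt_le_iff.2 ⟨hτ.le, by nlinarith⟩
    have hl0 : 0 < l := hs0.trans_le hsl
    have e1 : ∀ y, Set.indicator
        {z : ℝ × ℝ | z.1 ∈ Set.Ioo (-c) c ∧ γ₁ z.1 < z.2 ∧ z.2 < γ₂ z.1}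
        (fun z => ‖φ z‖ ^ 2) (x, y)
        = Set.indicator (Set.Ioo (γ₁ x) (γ₂ x)) (fun y => ‖φ (x, y)‖ ^ 2) y := by
      intro y
      have : (x ∈ Set.Ioo (-c) c ∧ γ₁ x < y ∧ y < γ₂ x) ↔ y ∈ Set.Ioo (γ₁ x) (γ₂ x) :=
        and_iff_right hx
      simp only [Set.indicator_apply, Set.mem_ofPred_eq, this]
    have e2 : ∀ y, Set.indicator {z : ℝ × ℝ | z.1 ^ 2 + z.2 ^ 2 < τ ^ 2}
        (fun z => 1 / Real.sqrt (τ ^ 2 - c ^ 2) * ‖φ z‖ ^ 2 + 4 * τ * ‖φ' z‖ ^ 2) (x, y)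
        = Set.indicator (Set.Ioo (-l) l) (fun y =>
          1 / Real.sqrt (τ ^ 2 - c ^ 2) * ‖φ (x, y)‖ ^ 2 + 4 * τ * ‖φ' (x, y)‖ ^ 2) y := by
      intro y
      have : (x ^ 2 + y ^ 2 < τ ^ 2) ↔ y ∈ Set.Ioo (-l) l := by
        rw [Set.mem_Ioo, ← abs_lt, hl, Real.lt_sqrt (abs_nonneg y), sq_abs]
        constructor <;> intro h <;> linarith
      simp only [Set.indicator_apply, Set.mem_ofPred_eq, this]
    simp only [e1, e2]
    rw [integral_indicator measurableSet_Ioo, integral_indicator measurableSet_Ioo,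
      ← integral_Ioc_eq_integral_Ioo, ← integral_Ioc_eq_integral_Ioo,
      ← intervalIntegral.integral_of_le hb2, ← intervalIntegral.integral_of_le (by linarith)]
    have c1 : Continuous fun y => φ (x, y) := by fun_prop
    have c2 : Continuous fun y => φ' (x, y) := by fun_prop
    rw [intervalIntegral.integral_add (Continuous.intervalIntegrable (by fun_prop) _ _)
      (Continuous.intervalIntegrable (by fun_prop) _ _), intervalIntegral.integral_const_mul,
      intervalIntegral.integral_const_mul]
    have n1 : 0 ≤ ∫ y in -l..l, ‖φ (x, y)‖ ^ 2 :=
      intervalIntegral.integral_nonneg (by linarith) fun _ _ => by positivity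
    have n2 : 0 ≤ ∫ y in -l..l, ‖φ' (x, y)‖ ^ 2 :=
      intervalIntegral.integral_nonneg (by linarith) fun _ _ => by positivity
    set H := 1 / Real.sqrt (τ ^ 2 - c ^ 2) * (∫ y in -l..l, ‖φ (x, y)‖ ^ 2)
      + 4 * τ * ∫ y in -l..l, ‖φ' (x, y)‖ ^ 2 with hH
    have hH0 : 0 ≤ H := by positivity
    have hsup : ∀ y ∈ Set.Icc (γ₁ x) (γ₂ x), ‖φ (x, y)‖ ^ 2 ≤ H := by
      intro y hy
      refine (norm_sq_le_integral_norm_sq_add (hd x) c2 hl0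
        ⟨hb1.trans hy.1, hy.2.trans hb3⟩).trans ?_
      exact add_le_add
        (mul_le_mul_of_nonneg_right (one_div_le_one_div_of_le hs0 hsl) n1)
        (mul_le_mul_of_nonneg_right (by linarith) n2)
    calc ∫ y in γ₁ x..γ₂ x, ‖φ (x, y)‖ ^ 2 ≤ ∫ _ in γ₁ x..γ₂ x, H :=
          intervalIntegral.integral_mono_on hb2
            (Continuous.intervalIntegrable (by fun_prop) _ _) (by simp) hsup
      _ = (γ₂ x - γ₁ x) * H := by simp
      _ ≤ δ * H := mul_le_mul_of_nonneg_right (hδ x hxI) hH0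
  · have e1 : ∀ y, Set.indicator
        {z : ℝ × ℝ | z.1 ∈ Set.Ioo (-c) c ∧ γ₁ z.1 < z.2 ∧ z.2 < γ₂ z.1}
        (fun z => ‖φ z‖ ^ 2) (x, y) = 0 := fun y =>
      Set.indicator_of_notMem (fun h => hx h.1) _
    simp only [e1, integral_zero]
    refine mul_nonneg hδ0 (integral_nonneg fun y => ?_)
    exact Set.indicator_nonneg (fun z _ => by positivity) _

theorem norm_smul_add_smul_sq (a b : ℝ) (u v : ℂ) :
    ‖a • u + b • v‖ ^ 2 = a ^ 2 * ‖u‖ ^ 2 + 2 * (a * b) * inner ℝ v u + b ^ 2 * ‖v‖ ^ 2 := by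
  rw [norm_add_sq_real, norm_smul, norm_smul, mul_pow, mul_pow, Real.norm_eq_abs,
    Real.norm_eq_abs, sq_abs, sq_abs, real_inner_smul_left, real_inner_smul_right,
    real_inner_comm]
  ring

/-- Analytic core of Theorem 2.2: under a compactly supported magnetic field
(support in the disk `B(0,c)`), the Landau gauge `A₁(x,y) = -∫_0^y B(x,t) dt`, a positive `C²`
ground state `g` with `-g'' - Ṽ g = e g`, the magnetic Hardy inequality on the disk `B(0,τ)`
with constant `𝓜 > 0`, and the smallness condition
`sup_Ω |Ṽ(y) - V(x,y)| ≤ (β/Γ) · min(𝓜√(τ²-c²)/2, 1/(8τ)) · δ⁻¹`,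
the quadratic form satisfies `q(ψ) ≥ e ∫ |ψ|²` for all `ψ = φ·g(y)`, `φ` smooth compactly
supported. -/
theorem form_lower_bound_no_discrete_spectrum
    (c τ : ℝ) (hc : 0 < c) (hcτ : c < τ)
    (B : ℝ × ℝ → ℝ) (hB : Continuous B)
    (hBsupp : Function.support B ⊆ {z : ℝ × ℝ | z.1 ^ 2 + z.2 ^ 2 < c ^ 2})
    (A₁ : ℝ × ℝ → ℝ) (hA₁ : ∀ x y : ℝ, A₁ (x, y) = -∫ t in (0:ℝ)..y, B (x, t))
    (Vt : ℝ → ℝ) (hVt : Continuous Vt) (hVtbdd : ∃ C : ℝ, ∀ y : ℝ, |Vt y| ≤ C)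
    (e : ℝ) (g : ℝ → ℝ) (hg : ContDiff ℝ 2 g) (hgpos : ∀ t : ℝ, 0 < g t)
    (hode : ∀ y : ℝ, -(deriv (deriv g) y) - Vt y * g y = e * g y)
    (γ₁ γ₂ : ℝ → ℝ)
    (hγ₁ : ContinuousOn γ₁ (Set.Icc (-c) c)) (hγ₂ : ContinuousOn γ₂ (Set.Icc (-c) c))
    (hbound : ∀ x ∈ Set.Icc (-c) c,
      -Real.sqrt (τ ^ 2 - x ^ 2) ≤ γ₁ x ∧ γ₁ x ≤ γ₂ x ∧ γ₂ x ≤ Real.sqrt (τ ^ 2 - x ^ 2))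
    (Ω : Set (ℝ × ℝ))
    (hΩ : Ω = {z : ℝ × ℝ | z.1 ∈ Set.Ioo (-c) c ∧ γ₁ z.1 < z.2 ∧ z.2 < γ₂ z.1})
    (δ : ℝ) (hδ : δ = sSup ((fun x => γ₂ x - γ₁ x) '' Set.Icc (-c) c)) (hδpos : 0 < δ)
    (V : ℝ × ℝ → ℝ) (hVmeas : Measurable V)
    (hVloc : ∀ K : Set (ℝ × ℝ), IsCompact K → ∃ C : ℝ, ∀ z ∈ K, |V z| ≤ C)
    (hVout : ∀ z : ℝ × ℝ, z ∉ Ω → V z = Vt z.2)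
    (𝓜 : ℝ) (h𝓜 : 0 < 𝓜)
    (hHardy : ∀ φ : ℝ × ℝ → ℂ, ContDiff ℝ (⊤ : ℕ∞) φ → HasCompactSupport φ →
      𝓜 * (∫ z in {z : ℝ × ℝ | z.1 ^ 2 + z.2 ^ 2 < τ ^ 2}, ‖φ z‖ ^ 2)
        ≤ ∫ z in {z : ℝ × ℝ | z.1 ^ 2 + z.2 ^ 2 < τ ^ 2},
            (‖Complex.I * pd1 φ z + (A₁ z : ℂ) * φ z‖ ^ 2 + ‖pd2 φ z‖ ^ 2))
    (β Γ : ℝ)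
    (hβ : IsLeast ((fun t => g t ^ 2) '' Set.Icc (-τ) τ) β)
    (hΓ : IsGreatest ((fun t => g t ^ 2) '' Set.Icc (-τ) τ) Γ)
    (hsmall : ∀ z ∈ Ω, |Vt z.2 - V z|
      ≤ (β / Γ) * min (𝓜 * Real.sqrt (τ ^ 2 - c ^ 2) / 2) (1 / (8 * τ)) * δ⁻¹)
    (φ : ℝ × ℝ → ℂ) (hφ : ContDiff ℝ (⊤ : ℕ∞) φ) (hφsupp : HasCompactSupport φ)
    (ψ : ℝ × ℝ → ℂ) (hψ : ∀ x y : ℝ, ψ (x, y) = φ (x, y) * (g y : ℂ)) :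
    (∫ z : ℝ × ℝ,
        (‖Complex.I * pd1 ψ z + (A₁ z : ℂ) * ψ z‖ ^ 2 + ‖pd2 ψ z‖ ^ 2 - V z * ‖ψ z‖ ^ 2))
      ≥ e * ∫ z : ℝ × ℝ, ‖ψ z‖ ^ 2 := by
  have hτ : 0 < τ := hc.trans hcτ
  have hs0 : 0 < Real.sqrt (τ ^ 2 - c ^ 2) :=
    Real.sqrt_pos.2 (sub_pos.2 (pow_lt_pow_left₀ hcτ hc.le two_ne_zero))
  have hγδ : ∀ x ∈ Set.Icc (-c) c, γ₂ x - γ₁ x ≤ δ := by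
    intro x hx
    rw [hδ]
    exact le_csSup (isCompact_Icc.bddAbove_image (hγ₂.sub hγ₁)) ⟨x, hx, rfl⟩
  have hgc : Continuous g := hg.continuous
  have hg1 : ContDiff ℝ 1 (deriv g) := (contDiff_succ_iff_deriv (n := 1).1 hg).2.2
  have hg'c : Continuous (deriv g) := hg1.continuous
  have hgd : ∀ y, HasDerivAt g (deriv g y) y := fun y =>
    (hg.differentiable (by simp) y).hasDerivAt
  have hgdd : ∀ y, HasDerivAt (deriv g) (-(Vt y + e) * g y) y := by
    intro y
    have h := (hg1.differentiable (by simp) y).hasDerivAt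
    rwa [show deriv (deriv g) y = -(Vt y + e) * g y by linarith [hode y]] at h
  have hAc : Continuous A₁ := by
    have : A₁ = fun z : ℝ × ℝ => -∫ t in (0:ℝ)..z.2, B (z.1, t) := by
      funext z
      exact hA₁ z.1 z.2
    rw [this]
    refine (intervalIntegral.continuous_parametric_intervalIntegral_of_continuous
      (f := fun (z : ℝ × ℝ) t => B (z.1, t)) ?_ continuous_snd).neg
    simp only [Function.uncurry_def]
    fun_prop
  have hφc : Continuous φ := hφ.continuous
  have hXc : Continuous (pd1 φ) := continuous_pd1 hφ
  have hYc : Continuous (pd2 φ) := continuous_pd2 hφ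
  have hYs := hasCompactSupport_pd2 hφ hφsupp
  have hψ' : ∀ z, ψ z = φ z * (g z.2 : ℂ) := fun z => hψ z.1 z.2
  have hψn : ∀ z, ‖ψ z‖ ^ 2 = g z.2 ^ 2 * ‖φ z‖ ^ 2 := by
    intro z
    rw [hψ', norm_mul, mul_pow, Complex.norm_real, Real.norm_eq_abs, sq_abs, mul_comm]
  have hψ1 : ∀ z, pd1 ψ z = pd1 φ z * (g z.2 : ℂ) := by
    intro z
    simp only [pd1, hψ']
    exact deriv_mul_const_field _
  have hψ2 : ∀ z, pd2 ψ z = (g z.2 : ℝ) • pd2 φ z + (deriv g z.2 : ℝ) • φ z := by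
    intro z
    have h := (hasDerivAt_pd2 hφ z.1 z.2).mul (hgd z.2).ofReal_comp
    have : pd2 ψ z = pd2 φ (z.1, z.2) * (g z.2 : ℂ) + φ (z.1, z.2) * ((deriv g z.2 : ℝ) : ℂ) := by
      rw [← h.deriv]
      simp only [pd2, hψ']
      rfl
    rw [this, Complex.real_smul, Complex.real_smul]
    ring
  set X : ℝ × ℝ → ℂ := fun z => Complex.I * pd1 φ z + (A₁ z : ℂ) * φ z with hX
  have hXn : ∀ z, ‖Complex.I * pd1 ψ z + (A₁ z : ℂ) * ψ z‖ ^ 2 = g z.2 ^ 2 * ‖X z‖ ^ 2 := by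
    intro z
    have : Complex.I * pd1 ψ z + (A₁ z : ℂ) * ψ z = X z * (g z.2 : ℂ) := by
      rw [hψ1, hψ']; ring
    rw [this, norm_mul, mul_pow, Complex.norm_real, Real.norm_eq_abs, sq_abs, mul_comm]
  set E : ℝ × ℝ → ℝ := fun z => ‖X z‖ ^ 2 + ‖pd2 φ z‖ ^ 2 with hE
  have hE0 : ∀ z, 0 ≤ E z := fun z => by positivity
  have hXcont : Continuous X :=
    (continuous_const.mul hXc).add ((Complex.continuous_ofReal.comp hAc).mul hφc)
  have hEc : Continuous E := by fun_prop
  have hXs : HasCompactSupport X := (hasCompactSupport_pd1 hφ hφsupp).mul_left.add hφsupp.mul_left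
  have hEs : HasCompactSupport E :=
    (hXs.comp_left (g := fun w : ℂ => ‖w‖ ^ 2) (by simp)).add
      (hYs.comp_left (g := fun w : ℂ => ‖w‖ ^ 2) (by simp))
  have hNs : HasCompactSupport fun z => ‖φ z‖ ^ 2 :=
    hφsupp.comp_left (g := fun w : ℂ => ‖w‖ ^ 2) (by simp)
  have hNi : Integrable fun z => ‖φ z‖ ^ 2 :=
    Continuous.integrable_of_hasCompactSupport (by fun_prop) hNs
  have hYi : Integrable fun z => ‖pd2 φ z‖ ^ 2 :=
    Continuous.integrable_of_hasCompactSupport (by fun_prop)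
      (hYs.comp_left (g := fun w : ℂ => ‖w‖ ^ 2) (by simp))
  have hEi : Integrable E := hEc.integrable_of_hasCompactSupport hEs
  -- the total derivative in the second variable
  set F' : ℝ × ℝ → ℝ := fun z => 2 * inner ℝ (φ z) (pd2 φ z) * (g z.2 * deriv g z.2)
    + ‖φ z‖ ^ 2 * (deriv g z.2 * deriv g z.2 + g z.2 * (-(Vt z.2 + e) * g z.2)) with hF'
  have hF'c : Continuous F' := by fun_prop
  have hF's : HasCompactSupport F' := by
    refine hφsupp.mono fun z hz h => hz ?_
    simp [hF', h]
  have hF'0 : ∫ z, F' z = 0 := by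
    have hFc : Continuous fun z : ℝ × ℝ => ‖φ z‖ ^ 2 * (g z.2 * deriv g z.2) := by fun_prop
    have hFs : HasCompactSupport fun z : ℝ × ℝ => ‖φ z‖ ^ 2 * (g z.2 * deriv g z.2) :=
      hφsupp.mono fun z hz h => hz (by simp [h])
    refine integral_eq_zero_of_hasDerivAt_snd hFc hF'c hFs hF's fun x y => ?_
    have h := (hasDerivAt_pd2 hφ x y).norm_sq.mul ((hgd y).mul (hgdd y))
    simp only [hF']
    exact h
  have hF'i : Integrable F' := hF'c.integrable_of_hasCompactSupport hF's
  have hψi : Integrable fun z => ‖ψ z‖ ^ 2 := by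
    simp only [hψn]
    exact Continuous.integrable_of_hasCompactSupport (by fun_prop) hNs.mul_left
  have hGEi : Integrable fun z : ℝ × ℝ => g z.2 ^ 2 * E z :=
    Continuous.integrable_of_hasCompactSupport (by fun_prop) hEs.mul_left
  have hVti : Integrable fun z : ℝ × ℝ => Vt z.2 * ‖ψ z‖ ^ 2 := by
    simp only [hψn]
    exact Continuous.integrable_of_hasCompactSupport (by fun_prop) hNs.mul_left.mul_left
  have hVi : Integrable fun z : ℝ × ℝ => V z * ‖ψ z‖ ^ 2 := by
    obtain ⟨C, hC⟩ := hVloc _ hφsupp.isCompact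
    refine Integrable.mono' (hψi.const_mul C)
      (hVmeas.aestronglyMeasurable.mul hψi.aestronglyMeasurable)
      (Filter.Eventually.of_forall fun z => ?_)
    by_cases hz : z ∈ tsupport φ
    · rw [norm_mul, Real.norm_eq_abs, Real.norm_of_nonneg (by positivity)]
      exact mul_le_mul_of_nonneg_right (hC z hz) (by positivity)
    · simp [hψn, image_eq_zero_of_notMem_tsupport hz]
  have hWi : Integrable fun z : ℝ × ℝ => g z.2 ^ 2 * E z + (Vt z.2 - V z) * ‖ψ z‖ ^ 2 := by
    refine hGEi.add ?_
    simp only [sub_mul]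
    exact hVti.sub hVi
  have hpt : ∀ z, ‖Complex.I * pd1 ψ z + (A₁ z : ℂ) * ψ z‖ ^ 2 + ‖pd2 ψ z‖ ^ 2 - V z * ‖ψ z‖ ^ 2
      = (g z.2 ^ 2 * E z + (Vt z.2 - V z) * ‖ψ z‖ ^ 2) + F' z + e * ‖ψ z‖ ^ 2 := by
    intro z
    rw [hXn, hψ2, norm_smul_add_smul_sq, hψn]
    simp only [hE, hF']
    ring
  simp_rw [hpt]
  have hWFi : Integrable fun z => (g z.2 ^ 2 * E z + (Vt z.2 - V z) * ‖ψ z‖ ^ 2) + F' z :=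
    hWi.add hF'i
  rw [integral_add hWFi (hψi.const_mul e), integral_add hWi hF'i, hF'0, add_zero,
    integral_const_mul, ge_iff_le, le_add_iff_nonneg_left]
  -- comparison with the disk and the region
  set m := min (𝓜 * Real.sqrt (τ ^ 2 - c ^ 2) / 2) (1 / (8 * τ)) with hm
  have hm0 : 0 ≤ m := le_min (by positivity) (by positivity)
  have hD := (isOpen_disk τ).measurableSet
  have hΩm : MeasurableSet Ω := by
    rw [hΩ]
    exact (isOpen_region_between hc hγ₁ hγ₂).measurableSet
  have hΩD : Ω ⊆ {z : ℝ × ℝ | z.1 ^ 2 + z.2 ^ 2 < τ ^ 2} := by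
    intro z hz
    rw [hΩ] at hz
    obtain ⟨hx, h1, h2⟩ := hz
    obtain ⟨b1, -, b3⟩ := hbound z.1 (Set.Ioo_subset_Icc_self hx)
    have h : |z.2| < Real.sqrt (τ ^ 2 - z.1 ^ 2) :=
      abs_lt.2 ⟨b1.trans_lt h1, h2.trans_le b3⟩
    rw [Real.lt_sqrt (abs_nonneg _), sq_abs] at h
    change z.1 ^ 2 + z.2 ^ 2 < τ ^ 2
    linarith
  have hDτ : ∀ z ∈ {z : ℝ × ℝ | z.1 ^ 2 + z.2 ^ 2 < τ ^ 2}, z.2 ∈ Set.Icc (-τ) τ := by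
    intro z hz
    have hz' : z.1 ^ 2 + z.2 ^ 2 < τ ^ 2 := hz
    exact abs_le.1 (abs_le_of_sq_le_sq (by nlinarith [sq_nonneg z.1]) hτ.le)
  have hβ0 : 0 < β := by
    obtain ⟨t, -, rfl⟩ := hβ.1
    exact pow_pos (hgpos t) 2
  have hΓ0 : 0 < Γ := by
    obtain ⟨t, -, rfl⟩ := hΓ.1
    exact pow_pos (hgpos t) 2
  have hlow : ∀ z, Set.indicator {z : ℝ × ℝ | z.1 ^ 2 + z.2 ^ 2 < τ ^ 2} (fun z => β * E z) z
      - Set.indicator Ω (fun z => β * (m * δ⁻¹) * ‖φ z‖ ^ 2) z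
      ≤ g z.2 ^ 2 * E z + (Vt z.2 - V z) * ‖ψ z‖ ^ 2 := by
    intro z
    have hdisk : Set.indicator {z : ℝ × ℝ | z.1 ^ 2 + z.2 ^ 2 < τ ^ 2} (fun z => β * E z) z
        ≤ g z.2 ^ 2 * E z := by
      refine Set.indicator_apply_le' (fun hz => ?_) (fun _ => by have := hE0 z; positivity)
      exact mul_le_mul_of_nonneg_right (hβ.2 ⟨z.2, hDτ z hz, rfl⟩) (hE0 z)
    by_cases hz : z ∈ Ω
    · rw [Set.indicator_of_mem hz (fun z => β * (m * δ⁻¹) * ‖φ z‖ ^ 2)]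
      have hgΓ : g z.2 ^ 2 ≤ Γ := hΓ.2 ⟨z.2, hDτ z (hΩD hz), rfl⟩
      have hVz := neg_le_of_abs_le (hsmall z hz)
      have h1 : (β / Γ * m * δ⁻¹) * ‖ψ z‖ ^ 2 ≤ β * (m * δ⁻¹) * ‖φ z‖ ^ 2 := by
        rw [hψn]
        calc (β / Γ * m * δ⁻¹) * (g z.2 ^ 2 * ‖φ z‖ ^ 2)
            ≤ (β / Γ * m * δ⁻¹) * (Γ * ‖φ z‖ ^ 2) := by gcongr
          _ = β * (m * δ⁻¹) * ‖φ z‖ ^ 2 := by field_simp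
      have h2 : -(β / Γ * m * δ⁻¹) * ‖ψ z‖ ^ 2 ≤ (Vt z.2 - V z) * ‖ψ z‖ ^ 2 :=
        mul_le_mul_of_nonneg_right hVz (by positivity)
      linarith
    · rw [Set.indicator_of_notMem hz, hVout z hz]
      linarith
  have hI1 := (hEi.const_mul β).indicator hD
  have hI2 := (hNi.const_mul (β * (m * δ⁻¹))).indicator hΩm
  refine le_trans ?_ (integral_mono (hI1.sub hI2) hWi hlow)
  simp only [Pi.sub_apply]
  rw [integral_sub hI1 hI2, integral_indicator hD, integral_indicator hΩm, integral_const_mul,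
    integral_const_mul, sub_nonneg, mul_assoc]
  refine mul_le_mul_of_nonneg_left ?_ hβ0.le
  have hreg := setIntegral_region_norm_sq_le hc hcτ hγ₁ hγ₂ hbound hγδ hδpos.le hφc hYc hφsupp hYs
    (hasDerivAt_pd2 hφ)
  rw [← hΩ, integral_add (hNi.const_mul _).integrableOn (hYi.const_mul _).integrableOn,
    integral_const_mul, integral_const_mul] at hreg
  have hT := hHardy φ hφ hφsupp
  change _ ≤ ∫ z in {z : ℝ × ℝ | z.1 ^ 2 + z.2 ^ 2 < τ ^ 2}, E z at hT
  have hY : ∫ z in {z : ℝ × ℝ | z.1 ^ 2 + z.2 ^ 2 < τ ^ 2}, ‖pd2 φ z‖ ^ 2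
      ≤ ∫ z in {z : ℝ × ℝ | z.1 ^ 2 + z.2 ^ 2 < τ ^ 2}, E z :=
    setIntegral_mono hYi.integrableOn hEi.integrableOn fun z =>
      le_add_of_nonneg_left (sq_nonneg _)
  have hN0 : 0 ≤ ∫ z in {z : ℝ × ℝ | z.1 ^ 2 + z.2 ^ 2 < τ ^ 2}, ‖φ z‖ ^ 2 :=
    integral_nonneg fun _ => by positivity
  have hY0 : 0 ≤ ∫ z in {z : ℝ × ℝ | z.1 ^ 2 + z.2 ^ 2 < τ ^ 2}, ‖pd2 φ z‖ ^ 2 :=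
    integral_nonneg fun _ => by positivity
  generalize (∫ z in {z : ℝ × ℝ | z.1 ^ 2 + z.2 ^ 2 < τ ^ 2}, E z) = T at *
  generalize (∫ z in {z : ℝ × ℝ | z.1 ^ 2 + z.2 ^ 2 < τ ^ 2}, ‖φ z‖ ^ 2) = N at *
  generalize (∫ z in {z : ℝ × ℝ | z.1 ^ 2 + z.2 ^ 2 < τ ^ 2}, ‖pd2 φ z‖ ^ 2) = Y at *
  have hm1 : m * (1 / Real.sqrt (τ ^ 2 - c ^ 2)) ≤ 𝓜 / 2 := by
    rw [mul_one_div, div_le_iff₀ hs0]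
    linarith [min_le_left (𝓜 * Real.sqrt (τ ^ 2 - c ^ 2) / 2) (1 / (8 * τ))]
  have hm2 : m * (4 * τ) ≤ 1 / 2 := by
    have h := min_le_right (𝓜 * Real.sqrt (τ ^ 2 - c ^ 2) / 2) (1 / (8 * τ))
    rw [← hm, le_div_iff₀ (by positivity)] at h
    linarith
  calc m * δ⁻¹ * ∫ z in Ω, ‖φ z‖ ^ 2
      ≤ m * δ⁻¹ * (δ * (1 / Real.sqrt (τ ^ 2 - c ^ 2) * N + 4 * τ * Y)) := by gcongr
    _ = m * (1 / Real.sqrt (τ ^ 2 - c ^ 2)) * N + m * (4 * τ) * Y := by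
        field_simp
    _ ≤ 𝓜 / 2 * N + 1 / 2 * Y := by gcongr
    _ ≤ T := by linarith
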